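/- Fix a real number ω₀ and a natural number N, and let I := {k ∈ ℤ : −N ≤ k ≤ N}. Suppose a : ℝ → (I → ℂ) is such that each coordinate z ↦ a_k(z) is differentiable and satisfies, for every k ∈ I and every z ∈ ℝ, the four-wave-mixing system a_k'(z) = −2i · Σ_{l, m, n ∈ I, l + m = n + k} exp(i Ω_{lmnk} z) · a_l(z) a_m(z) conj(a_n(z)). Then the total energy Σ_{k ∈ I} |a_k(z)|² is constant in z. -/

import Mathlib

open scoped ComplexConjugate

/-- The phase mismatch `Ω_{lmnk} = ω₀²(l² + m² - n² - k²)`. -/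
def Om (ω₀ : ℝ) (l m n k : ℤ) : ℝ :=
  ω₀ ^ 2 * ((l : ℝ) ^ 2 + (m : ℝ) ^ 2 - (n : ℝ) ^ 2 - (k : ℝ) ^ 2)

/-- A fourfold sum of a kernel that is Hermitian under exchanging the two index pairs is real. -/
lemma conj_sum_eq_self_of_pair_exchange {ι : Type*} (s : Finset ι) (F : ι → ι → ι → ι → ℂ)
    (hF : ∀ l m n k, conj (F l m n k) = F n k l m) :
    conj (∑ k ∈ s, ∑ t ∈ s ×ˢ s ×ˢ s, F t.1 t.2.1 t.2.2 k) =
      ∑ k ∈ s, ∑ t ∈ s ×ˢ s ×ˢ s, F t.1 t.2.1 t.2.2 k := by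
  simp only [map_sum, hF, ← Finset.sum_product']
  refine Finset.sum_nbij' (fun p => (p.2.2.1, p.2.2.2, p.1, p.2.1))
    (fun p => (p.2.2.1, p.2.2.2, p.1, p.2.1)) ?_ ?_ ?_ ?_ ?_ <;>
    simp +contextual [Finset.mem_product]

lemma Om_swap (ω₀ : ℝ) (l m n k : ℤ) : Om ω₀ n k l m = -Om ω₀ l m n k := by
  unfold Om
  ring

/-- The coupling term of four modes, vanishing off the resonance `l + m = n + k`. -/
noncomputable def couplingTerm (ω₀ z : ℝ) (b : ℤ → ℂ) (l m n k : ℤ) : ℂ :=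
  if l + m = n + k then
    Complex.exp (Complex.I * (Om ω₀ l m n k : ℂ) * z) * b l * b m * conj (b n) * conj (b k)
  else 0

lemma conj_couplingTerm (ω₀ z : ℝ) (b : ℤ → ℂ) (l m n k : ℤ) :
    conj (couplingTerm ω₀ z b l m n k) = couplingTerm ω₀ z b n k l m := by
  unfold couplingTerm
  by_cases h : l + m = n + k
  · rw [if_pos h, if_pos h.symm, Om_swap]
    simp only [map_mul, ← Complex.exp_conj, Complex.conj_conj]
    simp only [map_neg, Complex.conj_I, Complex.conj_ofReal, Complex.ofReal_neg,
      neg_mul, mul_neg, neg_neg]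
    ring
  · rw [if_neg h, if_neg (Ne.symm h), map_zero]

/-- Energy conservation for the finite-mode truncation of the NLS equation in
interaction-picture Fourier coordinates: if each mode `a_k`, `k ∈ I = [-N, N]`,
satisfies `a_k' = -2i Σ_{l,m,n ∈ I, l+m=n+k} exp(iΩ_{lmnk} z) a_l a_m a_n*`,
then the total energy `Σ_{k ∈ I} |a_k(z)|²` is constant in `z`. -/
theorem fourWaveMixing_energy_conservation (ω₀ : ℝ) (N : ℕ)
    (a : ℝ → ℤ → ℂ)
    (hderiv : ∀ k ∈ Finset.Icc (-(N : ℤ)) N, ∀ z : ℝ,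
      HasDerivAt (fun w : ℝ => a w k)
        (-2 * Complex.I *
          ∑ t ∈ (Finset.Icc (-(N : ℤ)) N ×ˢ Finset.Icc (-(N : ℤ)) N ×ˢ
              Finset.Icc (-(N : ℤ)) N).filter
            (fun t : ℤ × ℤ × ℤ => t.1 + t.2.1 = t.2.2 + k),
            Complex.exp (Complex.I * (Om ω₀ t.1 t.2.1 t.2.2 k : ℂ) * z) *
              a z t.1 * a z t.2.1 * conj (a z t.2.2)) z) :
    ∀ z w : ℝ,
      ∑ k ∈ Finset.Icc (-(N : ℤ)) N, ‖a z k‖ ^ 2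
        = ∑ k ∈ Finset.Icc (-(N : ℤ)) N, ‖a w k‖ ^ 2 := by
  set s := Finset.Icc (-(N : ℤ)) N
  have hE (z : ℝ) : HasDerivAt (fun w => ∑ k ∈ s, ‖a w k‖ ^ 2) 0 z := by
    refine (HasDerivAt.fun_sum fun k hk => (hderiv k hk z).norm_sq).congr_deriv ?_
    have hreal := Complex.conj_eq_iff_im.mp <| conj_sum_eq_self_of_pair_exchange s
      (couplingTerm ω₀ z (a z)) (conj_couplingTerm ω₀ z (a z))
    rw [← Finset.mul_sum]
    simp only [Complex.inner, ← Complex.re_sum]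
    have hsum : ∀ k ∈ s, (-2 * Complex.I *
          ∑ t ∈ (s ×ˢ s ×ˢ s).filter (fun t : ℤ × ℤ × ℤ => t.1 + t.2.1 = t.2.2 + k),
            Complex.exp (Complex.I * (Om ω₀ t.1 t.2.1 t.2.2 k : ℂ) * z) *
              a z t.1 * a z t.2.1 * conj (a z t.2.2)) * conj (a z k) =
        -2 * Complex.I * ∑ t ∈ s ×ˢ s ×ˢ s, couplingTerm ω₀ z (a z) t.1 t.2.1 t.2.2 k := by
      intro k _
      simp only [couplingTerm]
      rw [mul_assoc, Finset.sum_mul, Finset.sum_filter]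
    rw [Finset.sum_congr rfl hsum, ← Finset.mul_sum]
    simp [hreal]
  exact is_const_of_deriv_eq_zero (fun z => (hE z).differentiableAt) (fun z => (hE z).deriv)
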